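/- arXiv:2603.21961 — 3 statements merged into one kernel-verified Lean document; each statement's English description precedes it below -/
import Mathlib

section
/- Let κ ∈ ℕ and let f : (0,1) → ℝ be such that f is integrable on (x,1) for every x ∈ (0,1). (1) If f is (2κ+1)-times continuously differentiable on (0,1) and g(x) = f(x) − 2(2κ+1) x^{2κ} ∫_x^1 f(t) t^{−(2κ+1)} dt, then g is (2κ+1)-times differentiable on (0,1) and g^{(2κ+1)}(x) = ((4κ+2)/x)·f^{(2κ)}(x) + f^{(2κ+1)}(x) for every x ∈ (0,1). (2) If f is (2κ+2)-times continuously differentiable on (0,1) and g(x) = f(x) − 2(2κ+1) x^{2κ+1} ∫_x^1 f(t) t^{−(2κ+2)} dt, then g is (2κ+2)-times differentiable on (0,1) and g^{(2κ+2)}(x) = ((4κ+2)/x)·f^{(2κ+1)}(x) + f^{(2κ+2)}(x) for every x ∈ (0,1). -/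
open MeasureTheory

/-- Iterated differentiation of the Euler-type equation `x h' = a h - f` on an open interval. -/
theorem mul_iteratedDerivWithin_succ_of_euler {n : ℕ} {a : ℝ} {f h : ℝ → ℝ} {U : Set ℝ}
    (hU : IsOpen U)
    (hf : ContDiffOn ℝ (n + 1 : ℕ) f U) (hh : ContDiffOn ℝ (n + 1 : ℕ) h U)
    (euler : ∀ x ∈ U, x * derivWithin h U x = a * h x - f x) :
    ∀ m ≤ n, ∀ x ∈ U, x * iteratedDerivWithin (m + 1) h U x =
      (a - m) * iteratedDerivWithin m h U x - iteratedDerivWithin m f U x := by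
  have hasDeriv : ∀ {g : ℝ → ℝ}, ContDiffOn ℝ (n + 1 : ℕ) g U → ∀ m < n + 1, ∀ x ∈ U,
      HasDerivWithinAt (iteratedDerivWithin m g U) (iteratedDerivWithin (m + 1) g U x) U x := by
    intro g hg m hm x hx
    rw [iteratedDerivWithin_succ]
    exact ((hg.differentiableOn_iteratedDerivWithin (by exact_mod_cast hm)
      hU.uniqueDiffOn) x hx).hasDerivWithinAt
  intro m
  induction m with
  | zero =>
    intro _ x hx
    simpa [iteratedDerivWithin_one] using euler x hx
  | succ m ih =>
    intro hm x hx
    have hl := (hasDerivWithinAt_id x U).mul (hasDeriv hh (m + 1) (by lia) x hx)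
    have hr := ((hasDeriv hh m (by lia) x hx).const_mul (a - m)).sub
      (hasDeriv hf m (by lia) x hx)
    have heq := (hU.uniqueDiffWithinAt hx).eq_deriv _
      (hl.congr (fun y hy => (ih (by lia) y hy).symm) (ih (by lia) x hx).symm) hr
    simp only [id] at heq
    push_cast
    linear_combination heq

theorem hasDerivAt_setIntegral_Ioo_div_pow {f : ℝ → ℝ} (n : ℕ)
    (hint : ∀ x ∈ Set.Ioo (0 : ℝ) 1, IntegrableOn f (Set.Ioo x 1))
    (hf : ContinuousOn f (Set.Ioo 0 1)) {x : ℝ} (hx : x ∈ Set.Ioo (0 : ℝ) 1) :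
    HasDerivAt (fun x => ∫ t in Set.Ioo x 1, f t / t ^ n) (-(f x / x ^ n)) x := by
  have hcont : ContinuousOn (fun t => f t / t ^ n) (Set.Ioo 0 1) :=
    hf.div (by fun_prop) fun t ht => pow_ne_zero n ht.1.ne'
  have hU : Set.Ioo (0 : ℝ) 1 ∈ nhds x := isOpen_Ioo.mem_nhds hx
  have hii : IntervalIntegrable (fun t => f t / t ^ n) volume x 1 := by
    rw [intervalIntegrable_iff_integrableOn_Icc_of_le hx.2.le]
    have hfi : IntegrableOn f (Set.Icc x 1) :=
      (integrableOn_Icc_iff_integrableOn_Ioo (by simp) (by simp)).2 (hint x hx)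
    have hinv : ContinuousOn (fun t : ℝ => (t ^ n)⁻¹) (Set.Icc x 1) :=
      ContinuousOn.inv₀ (by fun_prop) fun t ht => pow_ne_zero n (hx.1.trans_le ht.1).ne'
    simpa only [div_eq_mul_inv] using hfi.mul_continuousOn hinv isCompact_Icc
  refine (intervalIntegral.integral_hasDerivAt_left hii
    (hcont.stronglyMeasurableAtFilter isOpen_Ioo x hx)
    (hcont.continuousAt hU)).congr_of_eventuallyEq ?_
  filter_upwards [hU] with y hy
  rw [intervalIntegral.integral_of_le hy.2.le, integral_Ioc_eq_integral_Ioo]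

theorem contDiffOn_setIntegral_Ioo_div_pow {f : ℝ → ℝ} (n k : ℕ)
    (hint : ∀ x ∈ Set.Ioo (0 : ℝ) 1, IntegrableOn f (Set.Ioo x 1))
    (hf : ContDiffOn ℝ k f (Set.Ioo 0 1)) :
    ContDiffOn ℝ k (fun x => ∫ t in Set.Ioo x 1, f t / t ^ n) (Set.Ioo 0 1) := by
  have hderiv := fun x hx => hasDerivAt_setIntegral_Ioo_div_pow n hint hf.continuousOn (x := x) hx
  refine ContDiffOn.of_le (n := (k : WithTop ℕ∞) + 1) ?_ le_self_add
  rw [contDiffOn_succ_iff_deriv_of_isOpen isOpen_Ioo]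
  refine ⟨fun x hx => (hderiv x hx).differentiableAt.differentiableWithinAt, by simp, ?_⟩
  refine ContDiffOn.congr (f := fun x => -(f x / x ^ n)) ?_ fun x hx => (hderiv x hx).deriv
  exact (hf.div (by fun_prop) fun t ht => pow_ne_zero n ht.1.ne').neg

theorem contDiffOn_and_iteratedDerivWithin_sub_pow_mul_setIntegral {f : ℝ → ℝ} (n : ℕ) (c : ℝ)
    (hint : ∀ x ∈ Set.Ioo (0 : ℝ) 1, IntegrableOn f (Set.Ioo x 1))
    (hf : ContDiffOn ℝ (n + 1 : ℕ) f (Set.Ioo 0 1)) :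
    ContDiffOn ℝ (n + 1 : ℕ)
        (fun x => f x - c * x ^ n * ∫ t in Set.Ioo x 1, f t / t ^ (n + 1)) (Set.Ioo 0 1) ∧
      ∀ x ∈ Set.Ioo (0 : ℝ) 1,
        iteratedDerivWithin (n + 1)
            (fun x => f x - c * x ^ n * ∫ t in Set.Ioo x 1, f t / t ^ (n + 1)) (Set.Ioo 0 1) x =
          c / x * iteratedDerivWithin n f (Set.Ioo 0 1) x +
            iteratedDerivWithin (n + 1) f (Set.Ioo 0 1) x := by
  let h : ℝ → ℝ := fun x => x ^ n * ∫ t in Set.Ioo x 1, f t / t ^ (n + 1)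
  have hh : ContDiffOn ℝ (n + 1 : ℕ) h (Set.Ioo 0 1) :=
    ContDiffOn.mul (by fun_prop) (contDiffOn_setIntegral_Ioo_div_pow (n + 1) (n + 1) hint hf)
  have heq : (fun x => f x - c * x ^ n * ∫ t in Set.Ioo x 1, f t / t ^ (n + 1)) = f - c • h := by
    ext x
    simp [h, mul_assoc]
  have hch : ContDiffOn ℝ (n + 1 : ℕ) (c • h) (Set.Ioo 0 1) := hh.const_smul c
  have euler : ∀ x ∈ Set.Ioo (0 : ℝ) 1,
      x * derivWithin h (Set.Ioo 0 1) x = n * h x - f x := by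
    intro x hx
    have hx0 : x ≠ 0 := hx.1.ne'
    have hd := (hasDerivAt_pow n x).mul
      (hasDerivAt_setIntegral_Ioo_div_pow (n + 1) hint hf.continuousOn hx)
    rw [derivWithin_of_isOpen isOpen_Ioo hx, show deriv h x = _ from hd.deriv]
    rcases n with _ | n
    · simp
      field_simp
    · simp only [h, Nat.add_sub_cancel]
      field_simp
      ring
  rw [heq]
  refine ⟨hf.sub hch, fun x hx => ?_⟩
  have hx0 : x ≠ 0 := hx.1.ne'
  have key := mul_iteratedDerivWithin_succ_of_euler isOpen_Ioo hf hh euler n le_rfl x hx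
  rw [iteratedDerivWithin_sub hx isOpen_Ioo.uniqueDiffOn (hf x hx) (hch x hx),
    iteratedDerivWithin_const_smul hx isOpen_Ioo.uniqueDiffOn c (hh x hx), smul_eq_mul]
  field_simp
  linear_combination -c * key

open MeasureTheory

theorem ODE_for_S_operators (κ : ℕ) (f : ℝ → ℝ)
    (hint : ∀ x ∈ Set.Ioo (0 : ℝ) 1, IntegrableOn f (Set.Ioo x 1)) :
    ((ContDiffOn ℝ (2 * κ + 1) f (Set.Ioo 0 1)) →
      (ContDiffOn ℝ (2 * κ + 1)
          (fun x => f x - 2 * (2 * (κ : ℝ) + 1) * x ^ (2 * κ) *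
            ∫ t in Set.Ioo x 1, f t / t ^ (2 * κ + 1)) (Set.Ioo 0 1) ∧
        ∀ x ∈ Set.Ioo (0 : ℝ) 1,
          iteratedDerivWithin (2 * κ + 1)
              (fun x => f x - 2 * (2 * (κ : ℝ) + 1) * x ^ (2 * κ) *
                ∫ t in Set.Ioo x 1, f t / t ^ (2 * κ + 1)) (Set.Ioo 0 1) x =
            (4 * (κ : ℝ) + 2) / x * iteratedDerivWithin (2 * κ) f (Set.Ioo 0 1) x +
              iteratedDerivWithin (2 * κ + 1) f (Set.Ioo 0 1) x)) ∧
    ((ContDiffOn ℝ (2 * κ + 2) f (Set.Ioo 0 1)) →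
      (ContDiffOn ℝ (2 * κ + 2)
          (fun x => f x - 2 * (2 * (κ : ℝ) + 1) * x ^ (2 * κ + 1) *
            ∫ t in Set.Ioo x 1, f t / t ^ (2 * κ + 2)) (Set.Ioo 0 1) ∧
        ∀ x ∈ Set.Ioo (0 : ℝ) 1,
          iteratedDerivWithin (2 * κ + 2)
              (fun x => f x - 2 * (2 * (κ : ℝ) + 1) * x ^ (2 * κ + 1) *
                ∫ t in Set.Ioo x 1, f t / t ^ (2 * κ + 2)) (Set.Ioo 0 1) x =
            (4 * (κ : ℝ) + 2) / x * iteratedDerivWithin (2 * κ + 1) f (Set.Ioo 0 1) x +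
              iteratedDerivWithin (2 * κ + 2) f (Set.Ioo 0 1) x)) := by
  have hc : 2 * (2 * (κ : ℝ) + 1) = 4 * κ + 2 := by ring
  rw [hc]
  refine ⟨fun hf => ?_, fun hf => ?_⟩
  · exact_mod_cast contDiffOn_and_iteratedDerivWithin_sub_pow_mul_setIntegral (2 * κ)
      (4 * κ + 2) hint (by exact_mod_cast hf)
  · exact_mod_cast contDiffOn_and_iteratedDerivWithin_sub_pow_mul_setIntegral (2 * κ + 1)
      (4 * κ + 2) hint (by exact_mod_cast hf)
end

section
/- Let X and Y be real Banach spaces, let U ⊆ X be open, let x₀ ∈ U, and let S : U → Y be continuously Fréchet differentiable on U. If the Fréchet differential of S at x₀ is injective and has closed range in Y, then there exists an open neighborhood V ⊆ U of x₀ such that the restriction of S to V is injective. -/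
theorem local_injectivity
    {X Y : Type*} [NormedAddCommGroup X] [NormedSpace ℝ X] [CompleteSpace X]
    [NormedAddCommGroup Y] [NormedSpace ℝ Y] [CompleteSpace Y]
    (U : Set X) (hU : IsOpen U) (x₀ : X) (hx₀ : x₀ ∈ U)
    (S : X → Y) (S' : X → X →L[ℝ] Y)
    (hderiv : ∀ x ∈ U, HasFDerivAt S (S' x) x)
    (hcont : ContinuousOn S' U)
    (hinj : Function.Injective (S' x₀))
    (hclosed : IsClosed (Set.range (S' x₀))) :
    ∃ V : Set X, V ⊆ U ∧ IsOpen V ∧ x₀ ∈ V ∧ Set.InjOn S V := by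
  obtain ⟨K, hK⟩ := (S' x₀).antilipschitz_of_injective_of_isClosed_range hinj hclosed
  have hU' : U ∈ nhds x₀ := hU.mem_nhds hx₀
  have hstrict : HasStrictFDerivAt S (S' x₀) x₀ :=
    hasStrictFDerivAt_of_hasFDerivAt_of_continuousAt
      (Filter.mem_of_superset hU' hderiv) (hcont.continuousAt hU')
  obtain ⟨t, ht, hbound⟩ := hstrict.approximates_deriv_on_nhds
    (c := (K + 1)⁻¹) (Or.inr (by positivity))
  refine ⟨U ∩ interior t, Set.inter_subset_left, hU.inter isOpen_interior,
    ⟨hx₀, mem_interior_iff_mem_nhds.mpr ht⟩, ?_⟩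
  intro x hx y hy hxy
  have hlin := hbound x (interior_subset hx.2) y (interior_subset hy.2)
  have hanti := hK.le_mul_dist x y
  simp only [hxy, sub_self, zero_sub, norm_neg, NNReal.coe_inv, NNReal.coe_add, NNReal.coe_one] at hlin
  rw [dist_eq_norm, dist_eq_norm, ← map_sub] at hanti
  have hsmall : (K + 1 : ℝ) * ‖S' x₀ (x - y)‖ ≤ ‖x - y‖ := by
    rw [← div_eq_inv_mul, le_div_iff₀ (by positivity)] at hlin
    linarith
  have hzero : S' x₀ (x - y) = 0 := by
    rw [← norm_le_zero_iff]
    linarith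
  exact sub_eq_zero.mp (hinj (by rw [hzero, map_zero]))
end

section
/- The function v : (0,1) → ℝ defined by v(x) = (2x² − 2x + 1)/(2x(1−x)) satisfies the second-order linear differential equation v″(x) + (1/x − 1/(1−x))·v′(x) − (2/x + 2/(1−x) + 1/x² + 1/(1−x)²)·v(x) = 0 for every x ∈ (0,1), together with v(1/2) = 1, v′(1/2) = 0 and the symmetry v(x) = v(1−x) for all x ∈ (0,1); moreover v does not belong to L²(0,1), i.e. ∫₀¹ v(x)² dx = +∞. -/
open MeasureTheory

/-- The explicit even solution of the linearized ODE for the pair `(0,1)`. -/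
noncomputable def vExplicit (x : ℝ) : ℝ :=
  (2 * x ^ 2 - 2 * x + 1) / (2 * x * (1 - x))

lemma vExplicit_eq {x : ℝ} (hx : x ∈ Set.Ioo (0 : ℝ) 1) :
    vExplicit x = (x⁻¹ + (1 - x)⁻¹) / 2 - 1 := by
  have h0 : x ≠ 0 := hx.1.ne'
  have h1 : 1 - x ≠ 0 := (sub_pos.2 hx.2).ne'
  unfold vExplicit
  field_simp
  ring

lemma deriv_vExplicit {x : ℝ} (hx : x ∈ Set.Ioo (0 : ℝ) 1) :
    deriv vExplicit x = (((1 - x) ^ 2)⁻¹ - (x ^ 2)⁻¹) / 2 := by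
  have h0 : x ≠ 0 := hx.1.ne'
  have h1 : 1 - x ≠ 0 := (sub_pos.2 hx.2).ne'
  have heq : vExplicit =ᶠ[nhds x] fun y => (y⁻¹ + (1 - y)⁻¹) / 2 - 1 := by
    filter_upwards [isOpen_Ioo.mem_nhds hx] with y hy using vExplicit_eq hy
  rw [heq.deriv_eq]
  have h := ((((hasDerivAt_id x).fun_inv h0).fun_add
    (((hasDerivAt_id x).const_sub 1).fun_inv h1)).div_const 2).sub_const 1
  refine h.deriv.trans ?_
  simp only [id]
  field_simp
  ring

lemma deriv_deriv_vExplicit {x : ℝ} (hx : x ∈ Set.Ioo (0 : ℝ) 1) :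
    deriv (deriv vExplicit) x = ((1 - x) ^ 3)⁻¹ + (x ^ 3)⁻¹ := by
  have h0 : x ≠ 0 := hx.1.ne'
  have h1 : 1 - x ≠ 0 := (sub_pos.2 hx.2).ne'
  have heq : deriv vExplicit =ᶠ[nhds x] fun y => (((1 - y) ^ 2)⁻¹ - (y ^ 2)⁻¹) / 2 := by
    filter_upwards [isOpen_Ioo.mem_nhds hx] with y hy using deriv_vExplicit hy
  rw [heq.deriv_eq]
  have h := (((((hasDerivAt_id x).const_sub 1).fun_pow 2).fun_inv (pow_ne_zero 2 h1)).fun_sub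
    (((hasDerivAt_id x).fun_pow 2).fun_inv (pow_ne_zero 2 h0))).div_const 2
  refine h.deriv.trans ?_
  simp only [id]
  field_simp
  ring

lemma inv_le_three_mul_vExplicit_sq {x : ℝ} (hx : x ∈ Set.Ioo (0 : ℝ) 1) :
    x⁻¹ ≤ 3 * vExplicit x ^ 2 := by
  have h0 : 0 < x := hx.1
  have h1 : 0 < 1 - x := sub_pos.2 hx.2
  have hone : 1 ≤ vExplicit x := by
    unfold vExplicit
    rw [le_div_iff₀ (by positivity)]
    nlinarith [sq_nonneg (2 * x - 1)]
  have hinv : 1 ≤ (1 - x)⁻¹ := (one_le_inv₀ h1).2 (by linarith)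
  have heq := vExplicit_eq hx
  nlinarith

lemma lintegral_vExplicit_sq :
    ∫⁻ x in Set.Ioo (0 : ℝ) 1, ENNReal.ofReal (vExplicit x ^ 2) = ⊤ := by
  by_contra hfin
  have hmeas : Measurable vExplicit := by
    unfold vExplicit
    fun_prop
  have hint : IntegrableOn (fun x => vExplicit x ^ 2) (Set.Ioo (0 : ℝ) 1) := by
    refine ⟨(hmeas.pow_const 2).aestronglyMeasurable, ?_⟩
    rw [hasFiniteIntegral_iff_ofReal (Filter.Eventually.of_forall fun x => sq_nonneg _)]
    exact lt_top_iff_ne_top.2 hfin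
  have hinv : IntegrableOn (fun x : ℝ => x⁻¹) (Set.Ioo (0 : ℝ) 1) := by
    refine (hint.const_mul 3).mono' measurable_inv.aestronglyMeasurable ?_
    filter_upwards [ae_restrict_mem measurableSet_Ioo] with x hx
    rw [Real.norm_of_nonneg (inv_nonneg.2 hx.1.le)]
    exact inv_le_three_mul_vExplicit_sq hx
  have h := (intervalIntegrable_iff_integrableOn_Ioo_of_le (μ := volume) zero_le_one).2 hinv
  simp [intervalIntegrable_inv_iff] at h

theorem explicit_solution_not_L2 :
    (∀ x ∈ Set.Ioo (0 : ℝ) 1,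
      deriv (deriv vExplicit) x +
          (1 / x - 1 / (1 - x)) * deriv vExplicit x -
          (2 / x + 2 / (1 - x) + 1 / x ^ 2 + 1 / (1 - x) ^ 2) * vExplicit x = 0) ∧
      vExplicit (1 / 2) = 1 ∧
      deriv vExplicit (1 / 2) = 0 ∧
      (∀ x ∈ Set.Ioo (0 : ℝ) 1, vExplicit x = vExplicit (1 - x)) ∧
      (∫⁻ x in Set.Ioo (0 : ℝ) 1, ENNReal.ofReal ((vExplicit x) ^ 2)) = ⊤ := by
  refine ⟨fun x hx => ?_, ?_, ?_, fun x _ => ?_, lintegral_vExplicit_sq⟩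
  · have h0 : x ≠ 0 := hx.1.ne'
    have h1 : 1 - x ≠ 0 := (sub_pos.2 hx.2).ne'
    rw [deriv_deriv_vExplicit hx, deriv_vExplicit hx, vExplicit_eq hx]
    field_simp
    ring
  · norm_num [vExplicit]
  · rw [deriv_vExplicit (by norm_num)]
    norm_num
  · unfold vExplicit
    congr 1 <;> ring
end
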